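/- Let (P_t)_{t∈T} be a family of projection-valued measures on a complex Hilbert space H, where P_t is a PVM on (Λ_t, F_t) and each Λ_t is nonempty. For every state φ on L(H) there exists a unique normalized finitely additive real-valued measure μ_φ on the algebra A_Λ of cylinder sets of Λ = Π_{t∈T} Λ_t such that μ_φ(π_{t₁}⁻¹(B₁) ∩ ⋯ ∩ π_{tₙ}⁻¹(Bₙ)) = (1/n!)·φ({P_{t₁}(B₁)·…·P_{tₙ}(Bₙ)}_sym) for every finite collection of distinct indices t₁,…,tₙ ∈ T and all B₁ ∈ F_{t₁}, …, Bₙ ∈ F_{tₙ} (the right-hand side is a real number since the symmetrized product is self-adjoint). -/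

import Mathlib

open scoped BigOperators

/-- An algebra of subsets of a set `α`. -/
structure SetAlgebra (α : Type*) where
  sets : Set (Set α)
  univ_mem : Set.univ ∈ sets
  compl_mem : ∀ ⦃s : Set α⦄, s ∈ sets → sᶜ ∈ sets
  union_mem : ∀ ⦃s t : Set α⦄, s ∈ sets → t ∈ sets → s ∪ t ∈ sets

/-- A projection-valued measure on `(Λ, F)` with values in the bounded operators on `H`. -/
structure PVM (H : Type*) [NormedAddCommGroup H] [InnerProductSpace ℂ H]
    [CompleteSpace H] {Λ : Type*} (F : SetAlgebra Λ) where
  toFun : Set Λ → (H →L[ℂ] H)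
  isSelfAdjoint_of_mem : ∀ ⦃B : Set Λ⦄, B ∈ F.sets → IsSelfAdjoint (toFun B)
  idem_of_mem : ∀ ⦃B : Set Λ⦄, B ∈ F.sets → toFun B * toFun B = toFun B
  map_univ : toFun Set.univ = 1
  map_empty : toFun ∅ = 0
  map_union : ∀ ⦃B₁ B₂ : Set Λ⦄, B₁ ∈ F.sets → B₂ ∈ F.sets → Disjoint B₁ B₂ →
    toFun (B₁ ∪ B₂) = toFun B₁ + toFun B₂
  map_inter : ∀ ⦃B₁ B₂ : Set Λ⦄, B₁ ∈ F.sets → B₂ ∈ F.sets →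
    toFun (B₁ ∩ B₂) = toFun B₁ * toFun B₂

/-- The symmetrized product `{Z₁ ⋯ Zₙ}_sym`: the sum over all permutations `σ` of
the ordered operator products `Z_{σ(1)} ⋯ Z_{σ(n)}`. -/
noncomputable def symProd {H : Type*} [NormedAddCommGroup H] [InnerProductSpace ℂ H]
    [CompleteSpace H] {n : ℕ} (Z : Fin n → (H →L[ℂ] H)) : H →L[ℂ] H :=
  ∑ σ : Equiv.Perm (Fin n), (List.ofFn fun i => Z (σ i)).prod

/-- The algebra of subsets of `α` generated by a collection `G` of subsets:
the smallest collection containing `G` and `univ` and closed under complements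
and finite unions. -/
inductive GenAlg {α : Type*} (G : Set (Set α)) : Set α → Prop
  | basic {s : Set α} : s ∈ G → GenAlg G s
  | univ : GenAlg G Set.univ
  | compl {s : Set α} : GenAlg G s → GenAlg G sᶜ
  | union {s t : Set α} : GenAlg G s → GenAlg G t → GenAlg G (s ∪ t)

/-- The product algebra on `Π i, Λ i`: the algebra of subsets generated by the
rectangles `B₁ × ⋯ × Bₙ` with measurable sides `Bᵢ ∈ Fᵢ`. -/
def prodAlgebra {ι : Type*} {Λ : ι → Type*} (F : ∀ i, SetAlgebra (Λ i)) :
    Set (Set (∀ i, Λ i)) :=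
  {S | GenAlg {R | ∃ B : ∀ i, Set (Λ i), (∀ i, B i ∈ (F i).sets) ∧ R = Set.univ.pi B} S}

/-- The collection `A_Λ` of all cylinder sets of `Λ = Π_{t∈T} Λ_t`: sets of the form
`π_{(t₁,…,tₙ)}⁻¹(F)` for distinct indices `t₁,…,tₙ ∈ T` and `F` in the product algebra
on `Λ_{t₁} × ⋯ × Λ_{tₙ}`. -/
def cylinderSets {T : Type*} (Λ : T → Type*) (F : ∀ t, SetAlgebra (Λ t)) :
    Set (Set (∀ t, Λ t)) :=
  {A | ∃ (n : ℕ) (t : Fin n → T), Function.Injective t ∧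
        ∃ Fs ∈ prodAlgebra (fun j => F (t j)),
          A = (fun (x : ∀ s, Λ s) (j : Fin n) => x (t j)) ⁻¹' Fs}

open scoped ComplexOrder

/-- A state on `L(H)`: a linear functional `φ` with `φ(A* A) ≥ 0` for all `A` and
`φ(1) = 1`. -/
def IsState {H : Type*} [NormedAddCommGroup H] [InnerProductSpace ℂ H] [CompleteSpace H]
    (φ : (H →L[ℂ] H) →ₗ[ℂ] ℂ) : Prop :=
  φ 1 = 1 ∧ ∀ A : H →L[ℂ] H, 0 ≤ φ (star A * A)


section Helpers

theorem SetAlgebra.inter_mem {α : Type*} (F : SetAlgebra α) {s t : Set α}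
    (hs : s ∈ F.sets) (ht : t ∈ F.sets) : s ∩ t ∈ F.sets := by
  have := F.compl_mem (F.union_mem (F.compl_mem hs) (F.compl_mem ht))
  rwa [Set.compl_union, compl_compl, compl_compl] at this

open Classical in
/-- One coordinate: integration of simple functions with operator coefficients. -/
theorem pvm_one_dim {H : Type*} [NormedAddCommGroup H] [InnerProductSpace ℂ H]
    [CompleteSpace H] {Λ : Type*} {F : SetAlgebra Λ} (P : PVM H F) {ι : Type*}
    (A : ι → Set Λ) (hA : ∀ k, A k ∈ F.sets) (C : ι → (H →L[ℂ] H)) (s : Finset ι) :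
    ∀ (E : Set Λ), E ∈ F.sets → ∀ a : H →L[ℂ] H,
      (∀ y ∈ E, ∑ k ∈ s, (if y ∈ A k then C k else 0) = a) →
      ∑ k ∈ s, C k * P.toFun (A k ∩ E) = a * P.toFun E := by
  induction s using Finset.induction_on with
  | empty =>
    intro E _ a h
    rcases E.eq_empty_or_nonempty with rfl | ⟨y, hy⟩
    · simp [P.map_empty]
    · have := h y hy
      simp only [Finset.sum_empty] at this
      simp [← this]
  | insert j s hj ih =>
    intro E hE a h
    have hj1 : A j ∩ E ∈ F.sets := F.inter_mem (hA j) hE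
    have hj2 : (A j)ᶜ ∩ E ∈ F.sets := F.inter_mem (F.compl_mem (hA j)) hE
    have h1 := ih (A j ∩ E) hj1 (a - C j) (by
      intro y hy
      have := h y hy.2
      rw [Finset.sum_insert hj, if_pos hy.1] at this
      rw [← this]; abel)
    have h2 := ih ((A j)ᶜ ∩ E) hj2 a (by
      intro y hy
      have := h y hy.2
      rw [Finset.sum_insert hj, if_neg hy.1, zero_add] at this
      exact this)
    have split : ∀ D ∈ F.sets, P.toFun D = P.toFun (A j ∩ D) + P.toFun ((A j)ᶜ ∩ D) := by
      intro D hD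
      rw [← P.map_union (F.inter_mem (hA j) hD) (F.inter_mem (F.compl_mem (hA j)) hD)]
      · rw [← Set.union_inter_distrib_right, Set.union_compl_self, Set.univ_inter]
      · rw [Set.disjoint_left]
        rintro x ⟨hx, _⟩ ⟨hx', _⟩
        exact hx' hx
    rw [Finset.sum_insert hj]
    have h3 : ∑ k ∈ s, C k * P.toFun (A k ∩ E)
        = ∑ k ∈ s, C k * P.toFun (A k ∩ (A j ∩ E))
          + ∑ k ∈ s, C k * P.toFun (A k ∩ ((A j)ᶜ ∩ E)) := by
      rw [← Finset.sum_add_distrib]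
      refine Finset.sum_congr rfl fun k _ => ?_
      rw [← mul_add, split _ (F.inter_mem (hA k) hE), Set.inter_left_comm,
        Set.inter_left_comm (A j)ᶜ]
    rw [h3, h1, h2, split E hE, sub_mul, mul_add]
    abel

open Classical in
/-- Ordered products extend to the linear span of indicators of rectangles. -/
theorem ordered_prod_zero {H : Type*} [NormedAddCommGroup H] [InnerProductSpace ℂ H]
    [CompleteSpace H] {T : Type*} {Λ : T → Type*} [∀ t, Nonempty (Λ t)]
    {F : ∀ t, SetAlgebra (Λ t)} (P : ∀ t, PVM H (F t)) {ι : Type*} (s : Finset ι)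
    (B : ι → ∀ t, Set (Λ t)) (hB : ∀ k t, B k t ∈ (F t).sets) (l : List T) :
    l.Nodup → ∀ C : ι → (H →L[ℂ] H),
      (∀ x : ∀ t, Λ t, ∑ k ∈ s, (if ∀ t ∈ l, x t ∈ B k t then C k else 0) = 0) →
      ∑ k ∈ s, C k * (l.map fun t => (P t).toFun (B k t)).prod = 0 := by
  induction l with
  | nil =>
    intro _ C h
    have := h (fun t => Classical.arbitrary _)
    simpa using this
  | cons t l ih =>
    intro hl C h
    rw [List.nodup_cons] at hl
    simp only [List.map_cons, List.prod_cons, ← mul_assoc]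
    refine ih hl.2 (fun k => C k * (P t).toFun (B k t)) fun x => ?_
    have := pvm_one_dim (P t) (fun k => B k t) (fun k => hB k t)
      (fun k => if ∀ u ∈ l, x u ∈ B k u then C k else 0) s Set.univ (F t).univ_mem 0 (by
        intro y _
        refine Eq.trans ?_ (h (Function.update x t y))
        refine Finset.sum_congr rfl fun k _ => ?_
        have e : (∀ u ∈ l, Function.update x t y u ∈ B k u) ↔ ∀ u ∈ l, x u ∈ B k u := by
          refine forall₂_congr fun u hu => ?_
          rw [Function.update_of_ne]
          rintro rfl
          exact hl.1 hu
        simp only [List.forall_mem_cons, e, Function.update_self]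
        by_cases h1 : y ∈ B k t <;> by_cases h2 : ∀ u ∈ l, x u ∈ B k u <;> simp only [h1, h2] <;> simp)
    rw [zero_mul] at this
    refine Eq.trans ?_ this
    refine Finset.sum_congr rfl fun k _ => ?_
    rw [Set.inter_univ]
    split_ifs <;> simp

/-- Symmetrized product over a list of indices. -/
noncomputable def symL {A T : Type*} [Ring A] (f : T → A) (l : List T) : A :=
  ((l.permutations').map fun m => (m.map f).prod).sum

theorem symL_perm {A T : Type*} [Ring A] (f : T → A) {l l' : List T} (h : l.Perm l') :
    symL f l = symL f l' :=
  (h.permutations'.map _).sum_eq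

theorem symL_congr {A T : Type*} [Ring A] {f g : T → A} {l : List T}
    (h : ∀ t ∈ l, f t = g t) : symL f l = symL g l := by
  unfold symL
  congr 1
  refine List.map_congr_left fun m hm => ?_
  congr 1
  refine List.map_congr_left fun t ht => h t ?_
  exact (List.mem_permutations'.1 hm).mem_iff.1 ht

theorem aux_sum {A T : Type*} [Ring A] (f : T → A) (t : T) (ht : f t = 1) (c : A) (m : List T) :
    ((List.permutations'Aux t m).map fun m => c * (m.map f).prod).sum
      = ((m.length + 1 : ℕ) : A) * (c * (m.map f).prod) := by
  induction m generalizing c with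
  | nil => simp [List.permutations'Aux, ht]
  | cons y m ih =>
    have := ih (c * f y)
    simp only [List.permutations'Aux, List.map_cons, List.map_map, Function.comp_def,
      List.sum_cons, List.prod_cons, ht, one_mul, List.length_cons]
    simp only [← mul_assoc] at this ⊢
    rw [this]
    push_cast
    simp only [add_mul, one_mul, mul_assoc]
    abel

theorem symL_cons {A T : Type*} [Ring A] (f : T → A) (t : T) (ht : f t = 1) (l : List T) :
    symL f (t :: l) = ((l.length + 1 : ℕ) : A) * symL f l := by
  unfold symL
  rw [List.permutations', List.map_flatMap, List.flatMap_def, List.sum_flatten, List.map_map, ← List.sum_map_mul_left]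
  congr 1
  refine List.map_congr_left fun m hm => ?_
  rw [Function.comp_apply]
  have := aux_sum f t ht 1 m
  simp only [one_mul] at this
  rw [this, (List.mem_permutations'.1 hm).length_eq]

/-- Normalized symmetrized product over a list of indices. -/
noncomputable def normL {A T : Type*} [Ring A] [Algebra ℂ A] (f : T → A) (l : List T) : A :=
  (l.length.factorial : ℂ)⁻¹ • symL f l

theorem normL_append {A T : Type*} [Ring A] [Algebra ℂ A] (f : T → A) (k l : List T)
    (h : ∀ t ∈ k, f t = 1) : normL f (k ++ l) = normL f l := by
  induction k with
  | nil => rfl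
  | cons t k ih =>
    rw [List.forall_mem_cons] at h
    rw [← ih h.2, List.cons_append]
    unfold normL
    rw [symL_cons f t h.1, List.length_cons, Nat.factorial_succ, ← nsmul_eq_mul,
      ← Nat.cast_smul_eq_nsmul ℂ, smul_smul]
    congr 1
    push_cast
    have : ((k ++ l).length : ℂ) + 1 ≠ 0 := Nat.cast_add_one_ne_zero _
    have h2 : ((k ++ l).length.factorial : ℂ) ≠ 0 := by
      exact_mod_cast Nat.factorial_ne_zero _
    field_simp

theorem normL_perm {A T : Type*} [Ring A] [Algebra ℂ A] (f : T → A) {l l' : List T}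
    (h : l.Perm l') : normL f l = normL f l' := by
  unfold normL
  rw [symL_perm f h, h.length_eq]

open Classical in
theorem normL_subset {A T : Type*} [Ring A] [Algebra ℂ A] (f : T → A) {l l' : List T}
    (hl : l.Nodup) (hl' : l'.Nodup) (hs : l ⊆ l') (h : ∀ t ∉ l, f t = 1) :
    normL f l' = normL f l := by
  rw [← normL_append f (l'.filter fun t => t ∉ l) l]
  · refine normL_perm f ((List.perm_ext_iff_of_nodup hl' ?_).2 ?_)
    · refine List.Nodup.append (hl'.filter _) hl ?_
      intro t ht ht'
      simp at ht
      exact ht.2 ht'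
    · intro t
      simp only [List.mem_append, List.mem_filter, decide_eq_true_eq]
      have := @hs t
      tauto
  · intro t ht
    simp at ht
    exact h t ht.2

theorem symProd_eq_symL {H : Type*} [NormedAddCommGroup H] [InnerProductSpace ℂ H]
    [CompleteSpace H] {T : Type*} {n : ℕ} (t : Fin n → T) (f : T → (H →L[ℂ] H)) :
    symProd (fun i => f (t i)) = symL f (List.ofFn t) := by
  have hnd : (List.permutations' (List.finRange n)).Nodup :=
    (List.permutations_perm_permutations' _).nodup_iff.1
      (List.nodup_permutations _ (List.nodup_finRange n))
  have e1 : symL f (List.ofFn t) = symL (fun i => f (t i)) (List.finRange n) := by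
    unfold symL
    rw [List.ofFn_eq_map, ← List.map_permutations', List.map_map]
    simp [Function.comp_def]
  rw [e1]
  unfold symL symProd
  rw [← List.sum_toFinset _ hnd]
  refine Finset.sum_bij (fun σ _ => List.ofFn σ) ?_ ?_ ?_ ?_
  · intro σ _
    rw [List.mem_toFinset, List.mem_permutations']
    rw [List.perm_ext_iff_of_nodup (List.nodup_ofFn.2 σ.injective) (List.nodup_finRange n)]
    intro i
    simp only [List.mem_ofFn, List.mem_finRange, iff_true]
    exact σ.surjective i
  · intro σ _ τ _ h
    exact Equiv.ext fun i => congrFun (List.ofFn_injective h) i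
  · intro m hm
    rw [List.mem_toFinset, List.mem_permutations'] at hm
    have hlen : m.length = n := by simpa using hm.length_eq
    have hmn : m.Nodup := hm.nodup_iff.2 (List.nodup_finRange _)
    have hinj : Function.Injective (m.get ∘ Fin.cast hlen.symm) :=
      (List.nodup_iff_injective_get.1 hmn).comp (Fin.cast_injective _)
    refine ⟨Equiv.ofBijective _ (Finite.injective_iff_bijective.1 hinj), Finset.mem_univ _, ?_⟩
    apply List.ext_getElem
    · simp [hlen]
    · intro i h1 h2
      simp
  · intro σ _
    rw [List.map_ofFn]
    rfl

theorem star_symProd {H : Type*} [NormedAddCommGroup H] [InnerProductSpace ℂ H]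
    [CompleteSpace H] {n : ℕ} (Z : Fin n → (H →L[ℂ] H)) (hZ : ∀ i, IsSelfAdjoint (Z i)) :
    IsSelfAdjoint (symProd Z) := by
  have key : ∀ l : List (H →L[ℂ] H), (∀ z ∈ l, IsSelfAdjoint z) →
      star l.prod = l.reverse.prod := by
    intro l
    induction l with
    | nil => simp
    | cons a l ih =>
      intro h
      rw [List.forall_mem_cons] at h
      rw [List.prod_cons, star_mul, ih h.2, h.1.star_eq, List.reverse_cons, List.prod_append]
      simp
  unfold IsSelfAdjoint symProd
  rw [star_sum]
  refine Fintype.sum_equiv (Equiv.mulRight Fin.revPerm) _ _ fun σ => ?_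
  rw [key]
  · congr 1
    apply List.ext_getElem
    · simp
    · intro i h1 h2
      simp only [List.getElem_reverse, List.getElem_ofFn, Equiv.coe_mulRight,
        Equiv.Perm.coe_mul, Function.comp_apply, Fin.revPerm_apply]
      congr 2
      ext
      simp [Fin.rev]
      omega
  · intro z hz
    rw [List.mem_ofFn] at hz
    obtain ⟨i, rfl⟩ := hz
    exact hZ _

theorem state_im {H : Type*} [NormedAddCommGroup H] [InnerProductSpace ℂ H]
    [CompleteSpace H] (φ : (H →L[ℂ] H) →ₗ[ℂ] ℂ) (hφ : IsState φ) (A : H →L[ℂ] H)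
    (hA : IsSelfAdjoint A) : (φ A).im = 0 := by
  have h1 := hφ.2 (1 + A)
  have h2 := hφ.2 A
  have e : star (1 + A) * (1 + A) = 1 + (A + A) + star A * A := by
    rw [star_add, star_one, hA.star_eq, add_mul, mul_add, mul_add]
    simp only [one_mul, mul_one]
    abel
  rw [e, map_add, map_add, map_add, hφ.1] at h1
  have i1 := (Complex.le_def.1 h1).2
  have i2 := (Complex.le_def.1 h2).2
  simp only [Complex.add_im, Complex.zero_im, Complex.one_im] at i1 i2
  linarith

theorem exists_factor {V W : Type*} [AddCommGroup V] [Module ℂ V] [AddCommGroup W]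
    [Module ℂ W] (e : V →ₗ[ℂ] W) (v : V →ₗ[ℂ] ℂ) (h : ∀ c, e c = 0 → v c = 0) :
    ∃ g : W →ₗ[ℂ] ℂ, ∀ c, g (e c) = v c := by
  have hk : LinearMap.ker e ≤ LinearMap.ker v := fun c hc => h c hc
  obtain ⟨g, hg⟩ := LinearMap.exists_extend
    (((LinearMap.ker e).liftQ v hk).comp e.quotKerEquivRange.symm.toLinearMap)
  refine ⟨g, fun c => ?_⟩
  have := LinearMap.congr_fun hg ⟨e c, LinearMap.mem_range_self e c⟩
  simp only [LinearMap.comp_apply, Submodule.subtype_apply, LinearEquiv.coe_coe] at this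
  rw [this, LinearMap.quotKerEquivRange_symm_apply_image e c (LinearMap.mem_range_self e c)]
  simp

theorem sum_list_zero {ι A M : Type*} [AddCommGroup A] [Module ℂ A] (s : Finset ι)
    (c : ι → ℂ) (f : ι → M → A) (l : List M) (h : ∀ m ∈ l, ∑ b ∈ s, c b • f b m = 0) :
    ∑ b ∈ s, c b • (l.map (f b)).sum = 0 := by
  induction l with
  | nil => simp
  | cons m l ih =>
    rw [List.forall_mem_cons] at h
    simp only [List.map_cons, List.sum_cons, smul_add, Finset.sum_add_distrib]
    rw [h.1, ih h.2, add_zero]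

/-- Finitely supported measurable boxes. -/
abbrev Box {T : Type*} {Λ : T → Type*} (F : ∀ t, SetAlgebra (Λ t)) : Type _ :=
  {B : ∀ t, Set (Λ t) // (∀ t, B t ∈ (F t).sets) ∧ {t | B t ≠ Set.univ}.Finite}

set_option maxHeartbeats 1000000 in
open Classical in
theorem exists_functional {H : Type*} [NormedAddCommGroup H] [InnerProductSpace ℂ H]
    [CompleteSpace H] {T : Type*} {Λ : T → Type*} [∀ t, Nonempty (Λ t)]
    {F : ∀ t, SetAlgebra (Λ t)} (P : ∀ t, PVM H (F t)) (φ : (H →L[ℂ] H) →ₗ[ℂ] ℂ) :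
    ∃ g : ((∀ t, Λ t) → ℂ) →ₗ[ℂ] ℂ, ∀ (B : ∀ t, Set (Λ t)), (∀ t, B t ∈ (F t).sets) →
      ∀ l : List T, l.Nodup → (∀ t ∉ l, B t = Set.univ) →
        g ((Set.univ.pi B).indicator 1) = φ (normL (fun t => (P t).toFun (B t)) l) := by
  let S : Box F → List T := fun b => b.2.2.toFinset.toList
  have hS : ∀ b : Box F, ∀ l : List T, l.Nodup → (∀ t ∉ l, b.1 t = Set.univ) →
      normL (fun t => (P t).toFun (b.1 t)) l = normL (fun t => (P t).toFun (b.1 t)) (S b) := by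
    intro b l hl h
    refine normL_subset _ (Finset.nodup_toList _) hl ?_ ?_
    · intro t ht
      simp only [S, Finset.mem_toList, Set.Finite.mem_toFinset, Set.mem_ofPred_eq] at ht
      by_contra hc
      exact ht (h t hc)
    · intro t ht
      simp only [S, Finset.mem_toList, Set.Finite.mem_toFinset, Set.mem_ofPred_eq, not_not] at ht
      simp only [ht, (P t).map_univ]
  obtain ⟨g, hg⟩ := exists_factor
    (Finsupp.linearCombination ℂ (fun b : Box F => (Set.univ.pi b.1).indicator (1 : (∀ t, Λ t) → ℂ)))
    (Finsupp.linearCombination ℂ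
      (fun b : Box F => φ (normL (fun t => (P t).toFun (b.1 t)) (S b)))) (by
    intro c hc
    rw [Finsupp.linearCombination_apply, Finsupp.sum] at hc ⊢
    let L : List T := (c.support.biUnion fun b => b.2.2.toFinset).toList
    have hL : L.Nodup := Finset.nodup_toList _
    have hLb : ∀ b ∈ c.support, ∀ t ∉ L, b.1 t = Set.univ := by
      intro b hb t ht
      by_contra hne
      apply ht
      simp only [L, Finset.mem_toList, Finset.mem_biUnion]
      exact ⟨b, hb, by simpa using hne⟩
    have hord : ∀ m ∈ L.permutations', ∑ b ∈ c.support,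
        c b • (m.map fun t => (P t).toFun (b.1 t)).prod = 0 := by
      intro m hm
      have hm := List.mem_permutations'.1 hm
      have := ordered_prod_zero P c.support (fun b => b.1) (fun b => b.2.1) m
        (hm.nodup_iff.2 hL) (fun b => c b • 1) (by
          intro x
          have hx := congrFun hc x
          rw [Finset.sum_apply] at hx
          have : (∑ b ∈ c.support, (if ∀ t ∈ m, x t ∈ b.1 t then c b else 0)) = 0 := by
            refine Eq.trans ?_ hx
            refine Finset.sum_congr rfl fun b hb => ?_
            have e : (∀ t ∈ m, x t ∈ b.1 t) ↔ x ∈ Set.univ.pi b.1 := by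
              simp only [Set.mem_pi, Set.mem_univ, true_imp_iff]
              refine ⟨fun h t => ?_, fun h t _ => h t⟩
              by_cases ht : t ∈ L
              · exact h t (hm.mem_iff.2 ht)
              · rw [hLb b hb t ht]; trivial
            simp only [e, Pi.smul_apply, Set.indicator_apply, Pi.one_apply, smul_eq_mul,
              mul_ite, mul_one, mul_zero]
          calc _ = ∑ b ∈ c.support, (if ∀ t ∈ m, x t ∈ b.1 t then c b else 0) • (1 : H →L[ℂ] H) := by
                refine Finset.sum_congr rfl fun b _ => ?_
                split_ifs <;> simp
            _ = 0 := by rw [← Finset.sum_smul, this, zero_smul])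
      simpa using this
    have : ∑ b ∈ c.support, c b • normL (fun t => (P t).toFun (b.1 t)) (S b) = 0 := by
      have h1 : ∀ b ∈ c.support, c b • normL (fun t => (P t).toFun (b.1 t)) (S b)
          = (L.length.factorial : ℂ)⁻¹ • (c b • symL (fun t => (P t).toFun (b.1 t)) L) := by
        intro b hb
        rw [← hS b L hL (hLb b hb), normL, smul_comm]
      rw [Finset.sum_congr rfl h1, ← Finset.smul_sum]
      unfold symL
      have h2 := sum_list_zero c.support c
        (fun (b : Box F) (m : List T) => (m.map fun t => (P t).toFun (b.1 t)).prod)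
        L.permutations' hord
      rw [h2, smul_zero]
    rw [← map_zero φ, ← this, map_sum]
    simp only [map_smul])
  refine ⟨g, fun B hB l hl h => ?_⟩
  have hfin : {t | B t ≠ Set.univ}.Finite := by
    refine (l.toFinset.finite_toSet).subset fun t ht => ?_
    by_contra hc
    exact ht (h t (by simpa using hc))
  have := hg (Finsupp.single (⟨B, hB, hfin⟩ : Box F) 1)
  rw [Finsupp.linearCombination_single, Finsupp.linearCombination_single, one_smul,
    one_smul] at this
  rw [hS ⟨B, hB, hfin⟩ l hl h]
  exact this

theorem genAlg_inter {α : Type*} {G : Set (Set α)} {s t : Set α} (hs : GenAlg G s)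
    (ht : GenAlg G t) : GenAlg G (s ∩ t) := by
  have := (hs.compl.union ht.compl).compl
  rwa [Set.compl_union, compl_compl, compl_compl] at this

theorem genAlg_null {α : Type*} {G : Set (Set α)} (hG : ∀ s ∈ G, ∀ t ∈ G, s ∩ t ∈ G)
    (hu : Set.univ ∈ G) (ν : Set α → ℝ)
    (hadd : ∀ s t, GenAlg G s → GenAlg G t → Disjoint s t → ν (s ∪ t) = ν s + ν t)
    (h0 : ∀ s ∈ G, ν s = 0) {S : Set α} (hS : GenAlg G S) : ν S = 0 := by
  have hc : ∀ E A R : Set α, GenAlg G E → GenAlg G A → GenAlg G R →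
      ν (E ∩ R) = ν (E ∩ A ∩ R) + ν (E ∩ Aᶜ ∩ R) := by
    intro E A R hE hA hR
    rw [← hadd _ _ (genAlg_inter (genAlg_inter hE hA) hR)
      (genAlg_inter (genAlg_inter hE hA.compl) hR)]
    · congr 1
      rw [← Set.union_inter_distrib_right, Set.inter_union_compl]
    · rw [Set.disjoint_left]
      rintro x ⟨⟨_, hx⟩, _⟩ ⟨⟨_, hx'⟩, _⟩
      exact hx' hx
  have key : ∀ E, GenAlg G E → (∀ R ∈ G, ν (E ∩ R) = 0) → ∀ R ∈ G, ν (E ∩ S ∩ R) = 0 := by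
    induction hS with
    | basic hs =>
      intro E _ hE R hR
      rw [Set.inter_assoc]
      exact hE _ (hG _ hs _ hR)
    | univ =>
      intro E _ hE R hR
      rw [Set.inter_univ]
      exact hE R hR
    | @compl A hA ih =>
      intro E hEG hE R hR
      have := hc E A R hEG hA (.basic hR)
      rw [hE R hR, ih E hEG hE R hR] at this
      linarith
    | @union A B hA hB ihA ihB =>
      intro E hEG hE R hR
      have h1 : ∀ R ∈ G, ν (E ∩ Aᶜ ∩ R) = 0 := by
        intro R hR
        have := hc E A R hEG hA (.basic hR)
        rw [hE R hR, ihA E hEG hE R hR] at this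
        linarith
      have h2 := ihB _ (genAlg_inter hEG hA.compl) h1 R hR
      have := hc (E ∩ (A ∪ B)) A R (genAlg_inter hEG (hA.union hB)) hA (.basic hR)
      rw [this]
      have e1 : E ∩ (A ∪ B) ∩ A ∩ R = E ∩ A ∩ R := by
        ext x; simp only [Set.mem_inter_iff, Set.mem_union]; tauto
      have e2 : E ∩ (A ∪ B) ∩ Aᶜ ∩ R = E ∩ Aᶜ ∩ B ∩ R := by
        ext x; simp only [Set.mem_inter_iff, Set.mem_union, Set.mem_compl_iff]; tauto
      rw [e1, e2, ihA E hEG hE R hR, h2, add_zero]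
  have := key Set.univ .univ (fun R hR => by rw [Set.univ_inter]; exact h0 R hR) _ hu
  simpa using this

theorem exists_box {T : Type*} {Λ : T → Type*} {F : ∀ t, SetAlgebra (Λ t)} {n : ℕ}
    (t : Fin n → T) (ht : Function.Injective t) (B : ∀ i, Set (Λ (t i)))
    (hB : ∀ i, B i ∈ (F (t i)).sets) :
    ∃ B' : ∀ s, Set (Λ s), (∀ s, B' s ∈ (F s).sets) ∧ (∀ i, B' (t i) = B i) ∧
      ∀ s ∉ List.ofFn t, B' s = Set.univ := by
  let B' : ∀ s, Set (Λ s) := fun s => {y | ∀ i (h : s = t i), (h ▸ y : Λ (t i)) ∈ B i}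
  have h1 : ∀ i, B' (t i) = B i := by
    intro i
    ext y
    refine ⟨fun h => h i rfl, fun h j hj => ?_⟩
    obtain rfl := ht hj
    exact h
  have h2 : ∀ s ∉ List.ofFn t, B' s = Set.univ := by
    intro s hs
    refine Set.eq_univ_of_forall fun y i h => ?_
    exact absurd (List.mem_ofFn.2 ⟨i, h.symm⟩) hs
  refine ⟨B', fun s => ?_, h1, h2⟩
  by_cases hs : s ∈ List.ofFn t
  · obtain ⟨i, rfl⟩ := List.mem_ofFn.1 hs
    rw [h1]; exact hB i
  · rw [h2 s hs]; exact (F s).univ_mem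

end Helpers

/-- **Proposition 1 of the paper.** For a family `(P_t)_{t∈T}` of PVMs on
nonempty spaces and every state `φ` on `L(H)` there exists a unique normalized finitely
additive real-valued measure `μ_φ` on the algebra of cylinder sets of `Λ = Π_{t∈T} Λ_t`
such that `μ_φ(π_{t₁}⁻¹(B₁) ∩ ⋯ ∩ π_{tₙ}⁻¹(Bₙ)) = (1/n!)·φ({P_{t₁}(B₁)⋯P_{tₙ}(Bₙ)}_sym)`
for all finite collections of distinct indices and `Bᵢ ∈ F_{tᵢ}` (the equality is stated
in `ℂ`, which expresses that the right-hand side is a real number). -/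
theorem exists_unique_real_valued_measure_of_state
    {H : Type*} [NormedAddCommGroup H] [InnerProductSpace ℂ H] [CompleteSpace H]
    {T : Type*} [Nonempty T] {Λ : T → Type*} [∀ t, Nonempty (Λ t)]
    {F : ∀ t, SetAlgebra (Λ t)} (P : ∀ t, PVM H (F t))
    (φ : (H →L[ℂ] H) →ₗ[ℂ] ℂ) (hφ : IsState φ) :
    ∃ μ : Set (∀ t, Λ t) → ℝ,
      μ Set.univ = 1 ∧
      (∀ ⦃A B : Set (∀ t, Λ t)⦄, A ∈ cylinderSets Λ F → B ∈ cylinderSets Λ F →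
        Disjoint A B → μ (A ∪ B) = μ A + μ B) ∧
      (∀ (n : ℕ) (t : Fin n → T), Function.Injective t →
        ∀ (B : ∀ i : Fin n, Set (Λ (t i))), (∀ i, B i ∈ (F (t i)).sets) →
          (n.factorial : ℂ)⁻¹ * φ (symProd (fun i => (P (t i)).toFun (B i))) =
            (μ (⋂ i : Fin n, (fun x : ∀ s, Λ s => x (t i)) ⁻¹' B i) : ℂ)) ∧
      (∀ μ' : Set (∀ t, Λ t) → ℝ,
        μ' Set.univ = 1 →
        (∀ ⦃A B : Set (∀ t, Λ t)⦄, A ∈ cylinderSets Λ F → B ∈ cylinderSets Λ F →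
          Disjoint A B → μ' (A ∪ B) = μ' A + μ' B) →
        (∀ (n : ℕ) (t : Fin n → T), Function.Injective t →
          ∀ (B : ∀ i : Fin n, Set (Λ (t i))), (∀ i, B i ∈ (F (t i)).sets) →
            (n.factorial : ℂ)⁻¹ * φ (symProd (fun i => (P (t i)).toFun (B i))) =
              (μ' (⋂ i : Fin n, (fun x : ∀ s, Λ s => x (t i)) ⁻¹' B i) : ℂ)) →
        ∀ A ∈ cylinderSets Λ F, μ' A = μ A) := by
  classical
  obtain ⟨g, hg⟩ := exists_functional P φ
  have hbox : ∀ (n : ℕ) (t : Fin n → T), Function.Injective t →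
        ∀ (B : ∀ i : Fin n, Set (Λ (t i))), (∀ i, B i ∈ (F (t i)).sets) →
          (n.factorial : ℂ)⁻¹ * φ (symProd (fun i => (P (t i)).toFun (B i))) =
            g ((⋂ i : Fin n, (fun x : ∀ s, Λ s => x (t i)) ⁻¹' B i).indicator 1) := by
    intro n t ht B hB
    obtain ⟨B', hB', h1, h2⟩ := exists_box t ht B hB
    have e : (⋂ i : Fin n, (fun x : ∀ s, Λ s => x (t i)) ⁻¹' B i) = Set.univ.pi B' := by
      ext x
      simp only [Set.mem_iInter, Set.mem_preimage, Set.mem_pi, Set.mem_univ, true_imp_iff]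
      refine ⟨fun h s => ?_, fun h i => h1 i ▸ h (t i)⟩
      by_cases hs : s ∈ List.ofFn t
      · obtain ⟨i, rfl⟩ := List.mem_ofFn.1 hs
        rw [h1]; exact h i
      · rw [h2 s hs]; trivial
    rw [e, hg B' hB' _ (List.nodup_ofFn.2 ht) h2, normL, ← symProd_eq_symL, map_smul,
      List.length_ofFn, smul_eq_mul]
    simp only [h1]
  have hμ : ∀ (n : ℕ) (t : Fin n → T), Function.Injective t →
        ∀ (B : ∀ i : Fin n, Set (Λ (t i))), (∀ i, B i ∈ (F (t i)).sets) →
          (n.factorial : ℂ)⁻¹ * φ (symProd (fun i => (P (t i)).toFun (B i))) =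
            (((g ((⋂ i : Fin n, (fun x : ∀ s, Λ s => x (t i)) ⁻¹' B i).indicator 1)).re : ℝ) : ℂ) := by
    intro n t ht B hB
    rw [← hbox n t ht B hB]
    have him := state_im φ hφ _ (star_symProd (fun i => (P (t i)).toFun (B i))
      fun i => (P (t i)).isSelfAdjoint_of_mem (hB i))
    have hf : ((n.factorial : ℂ)⁻¹).im = 0 := by
      rw [← Complex.ofReal_natCast, ← Complex.ofReal_inv, Complex.ofReal_im]
    apply Complex.ext
    · simp
    · rw [Complex.ofReal_im, Complex.mul_im, him, hf]; simp
  have hadd : ∀ A B : Set (∀ t, Λ t), Disjoint A B →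
      (g ((A ∪ B).indicator 1)).re = (g (A.indicator 1)).re + (g (B.indicator 1)).re := by
    intro A B h
    rw [Set.indicator_union_of_disjoint h, ← Complex.add_re, ← map_add]
    rfl
  refine ⟨fun A => (g (A.indicator 1)).re, ?_, fun A B _ _ h => hadd A B h, hμ, ?_⟩
  · have := hμ 0 Fin.elim0 (fun i => i.elim0) (fun i => i.elim0) (fun i => i.elim0)
    simp [symProd, hφ.1] at this
    simp only [Set.indicator_univ]
    exact_mod_cast this.symm
  · intro μ' _ hadd' hμ' A hA
    obtain ⟨n, t, ht, Fs, hFs, rfl⟩ := hA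
    rw [← sub_eq_zero]
    refine genAlg_null ?_ ?_ (fun S => μ' ((fun (x : ∀ s, Λ s) (j : Fin n) => x (t j)) ⁻¹' S)
      - (g (((fun (x : ∀ s, Λ s) (j : Fin n) => x (t j)) ⁻¹' S).indicator 1)).re) ?_ ?_ hFs
    · rintro _ ⟨B, hB, rfl⟩ _ ⟨B', hB', rfl⟩
      exact ⟨fun i => B i ∩ B' i, fun i => (F (t i)).inter_mem (hB i) (hB' i),
        Set.pi_inter_distrib.symm⟩
    · exact ⟨fun i => Set.univ, fun i => (F (t i)).univ_mem, by simp⟩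
    · intro S S' hS hS' hd
      have hd' := hd.preimage (fun (x : ∀ s, Λ s) (j : Fin n) => x (t j))
      simp only [Set.preimage_union]
      rw [hadd _ _ hd', hadd' ⟨n, t, ht, S, hS, rfl⟩ ⟨n, t, ht, S', hS', rfl⟩ hd']
      ring
    · rintro _ ⟨B, hB, rfl⟩
      have e : (fun (x : ∀ s, Λ s) (j : Fin n) => x (t j)) ⁻¹' (Set.univ.pi B)
          = ⋂ i : Fin n, (fun x : ∀ s, Λ s => x (t i)) ⁻¹' B i := by
        ext x; simp
      have h1 := hμ' n t ht B hB
      rw [hμ n t ht B hB] at h1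
      simp only [e]
      rw [Complex.ofReal_inj.1 h1, sub_self]
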